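/- Let M₂ and R₂ be the S-Heun operators on the discrete linear grid, M₂ = ½x(T₊−T₋) and R₂ = ½x(T₊+T₋). Then the commutator [M₂, R₂] = M₂R₂ − R₂M₂ equals the operator of multiplication by the variable: for every function f : ℝ → ℝ and every x ∈ ℝ, ([M₂,R₂]f)(x) = x·f(x). -/

import Mathlib

/-- Lowering S-Heun operator `L = ½(T₊ − T₋)` on the discrete linear grid. -/
noncomputable def opL (f : ℝ → ℝ) : ℝ → ℝ := fun x => (f (x+1) - f (x-1)) / 2
/-- Stabilizing S-Heun operator `M₁ = ½(T₊ + T₋)`. -/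
noncomputable def opM1 (f : ℝ → ℝ) : ℝ → ℝ := fun x => (f (x+1) + f (x-1)) / 2
/-- Stabilizing S-Heun operator `M₂ = ½ x (T₊ − T₋)`. -/
noncomputable def opM2 (f : ℝ → ℝ) : ℝ → ℝ := fun x => x * (f (x+1) - f (x-1)) / 2
/-- Raising S-Heun operator `R₁ = ½ x [(1−2x)T₊ + (1+2x)T₋]`. -/
noncomputable def opR1 (f : ℝ → ℝ) : ℝ → ℝ :=
  fun x => x * ((1 - 2*x) * f (x+1) + (1 + 2*x) * f (x-1)) / 2
/-- Raising S-Heun operator `R₂ = ½ x (T₊ + T₋)`. -/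
noncomputable def opR2 (f : ℝ → ℝ) : ℝ → ℝ := fun x => x * (f (x+1) + f (x-1)) / 2

/-- The commutator `[M₂, R₂]` equals multiplication by the variable. -/
theorem stmt_10 :
    ∀ (f : ℝ → ℝ) (x : ℝ),
      opM2 (opR2 f) x - opR2 (opM2 f) x = x * f x := by
  intro f x
  have h1 : x + 1 - 1 = x := by ring
  have h2 : x - 1 + 1 = x := by ring
  simp only [opM2, opR2, h1, h2]
  ring
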